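/- Let n ≥ 3 be an integer, let ν ≥ (n−2)/2 be real, and let σ > n/2. Then there exists a constant C > 0 (depending only on n, ν, σ) such that for every 0 < λ ≤ 1 and every measurable f : (0,∞) → ℂ with ∫₀^∞ |f(s)|² (1+s)^{2σ} s^{n−1} ds < ∞, one has (∫₀^∞ |∫₀^∞ (π/2)(rs)^{−(n−2)/2} J_ν(λr) J_ν(λs) f(s) s^{n−1} ds|² (1+r)^{−2σ} r^{n−1} dr)^{1/2} ≤ C λ^{n−2} (∫₀^∞ |f(s)|² (1+s)^{2σ} s^{n−1} ds)^{1/2}. -/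

import Mathlib

open MeasureTheory Real Set

/-- The Bessel function of the first kind of order `ν`, defined by its power series
(with the convention `1/Γ = 0` at the poles of `Γ`). -/
noncomputable def besselJ (ν : ℝ) (x : ℝ) : ℝ :=
  ∑' k : ℕ, ((-1 : ℝ) ^ k / ((k.factorial : ℝ) * Real.Gamma (ν + (k : ℝ) + 1))) *
    (x / 2) ^ (2 * (k : ℝ) + ν)

/-- The coefficients of the entire function `besselEntire ν`. -/
noncomputable def besselCoeff (ν : ℝ) (k : ℕ) : ℝ :=
  (-1 : ℝ) ^ k / ((k.factorial : ℝ) * Real.Gamma (ν + (k : ℝ) + 1))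

/-- The entire function `g` with `J_ν(x) = (x / 2) ^ ν * g (x ^ 2 / 4)`. -/
noncomputable def besselEntire (ν : ℝ) (z : ℝ) : ℝ := ∑' k : ℕ, besselCoeff ν k * z ^ k

lemma Gamma_add_one_le_Gamma_add_nat_add_one {ν : ℝ} (hν : 0 < ν) (k : ℕ) :
    Real.Gamma (ν + 1) ≤ Real.Gamma (ν + (k : ℝ) + 1) := by
  induction k with
  | zero => simp
  | succ k ih =>
    have hk : (0 : ℝ) ≤ k := k.cast_nonneg
    have h : Real.Gamma (ν + ((k + 1 : ℕ) : ℝ) + 1)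
        = (ν + k + 1) * Real.Gamma (ν + k + 1) := by
      rw [← Real.Gamma_add_one (by positivity)]
      push_cast
      ring_nf
    rw [h]
    have hpos : 0 < Real.Gamma (ν + k + 1) := Real.Gamma_pos_of_pos (by positivity)
    nlinarith

lemma abs_besselCoeff_le {ν : ℝ} (hν : 0 < ν) (k : ℕ) :
    |besselCoeff ν k| ≤ (Real.Gamma (ν + 1))⁻¹ * (1 / (k.factorial : ℝ)) := by
  have h0 : 0 < Real.Gamma (ν + 1) := Real.Gamma_pos_of_pos (by positivity)
  have h1 := Gamma_add_one_le_Gamma_add_nat_add_one hν k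
  have h2 : 0 < Real.Gamma (ν + k + 1) := h0.trans_le h1
  rw [besselCoeff, abs_div, abs_pow, abs_neg, abs_one, one_pow, abs_of_pos (by positivity),
    one_div, mul_inv, mul_comm, one_div]
  gcongr

lemma summable_besselCoeff_mul_pow {ν : ℝ} (hν : 0 < ν) (z : ℝ) :
    Summable fun k : ℕ => besselCoeff ν k * z ^ k := by
  refine Summable.of_norm_bounded
    ((Real.summable_pow_div_factorial |z|).mul_left (Real.Gamma (ν + 1))⁻¹) fun k => ?_
  rw [norm_mul, norm_pow, Real.norm_eq_abs, Real.norm_eq_abs]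
  calc _ ≤ (Real.Gamma (ν + 1))⁻¹ * (1 / (k.factorial : ℝ)) * |z| ^ k := by
        gcongr
        exact abs_besselCoeff_le hν k
    _ = _ := by ring

lemma succ_mul_besselCoeff_succ (ν : ℝ) (k : ℕ) :
    ((k : ℝ) + 1) * besselCoeff ν (k + 1) = -besselCoeff (ν + 1) k := by
  have h : ν + ((k + 1 : ℕ) : ℝ) + 1 = ν + 1 + k + 1 := by push_cast; ring
  have hk : (k.factorial : ℝ) ≠ 0 := by positivity
  have hk' : (k : ℝ) + 1 ≠ 0 := by positivity
  rw [besselCoeff, besselCoeff, h, Nat.factorial_succ, pow_succ]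
  push_cast
  by_cases hG : Real.Gamma (ν + 1 + k + 1) = 0
  · simp [hG]
  · field_simp

lemma besselCoeff_eq_mul_besselCoeff_add_one {ν : ℝ} (hν : 0 < ν) (k : ℕ) :
    besselCoeff ν k = ((k : ℝ) + (ν + 1)) * besselCoeff (ν + 1) k := by
  have hpos : 0 < Real.Gamma (ν + k + 1) := Real.Gamma_pos_of_pos (by positivity)
  have h : Real.Gamma (ν + 1 + k + 1) = (ν + k + 1) * Real.Gamma (ν + k + 1) := by
    rw [← Real.Gamma_add_one (by positivity)]
    ring_nf
  have hne : ν + k + 1 ≠ 0 := by positivity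
  rw [besselCoeff, besselCoeff, h]
  field_simp
  ring

lemma hasDerivAt_besselEntire {ν : ℝ} (hν : 0 < ν) (z : ℝ) :
    HasDerivAt (besselEntire ν) (-besselEntire (ν + 1) z) z := by
  set R : ℝ := |z| + 1
  have hR : 0 < R := by positivity
  have hterm (k : ℕ) (y : ℝ) : ((k + 1 : ℕ) : ℝ) * y ^ k * besselCoeff ν (k + 1)
      = -(besselCoeff (ν + 1) k * y ^ k) := by
    have := succ_mul_besselCoeff_succ ν k
    push_cast
    linear_combination y ^ k * this
  have hsum : Summable fun k : ℕ => |besselCoeff ν k| * (k * R ^ (k - 1)) := by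
    rw [← summable_nat_add_iff 1]
    refine (summable_besselCoeff_mul_pow (ν := ν + 1) (by positivity) R).abs.congr fun k => ?_
    have h := congrArg abs (hterm k R)
    rw [abs_neg, abs_mul, abs_of_nonneg (by positivity)] at h
    rw [← h, Nat.add_sub_cancel]
    ring
  have key := hasDerivAt_tsum_of_isPreconnected (𝕜 := ℝ) (F := ℝ)
    (g := fun k y => besselCoeff ν k * y ^ k)
    (g' := fun k y => besselCoeff ν k * (k * y ^ (k - 1))) (y₀ := 0) (y := z) hsum
    (Metric.isOpen_ball (x := (0 : ℝ)) (ε := R)) (convex_ball (0 : ℝ) R).isPreconnected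
    (fun k y _ => (hasDerivAt_pow k y).const_mul _)
    (fun k y hy => by
      have hy' : |y| ≤ R := by
        have := Metric.mem_ball.1 hy
        rw [Real.dist_eq, sub_zero] at this
        exact this.le
      rw [norm_mul, norm_mul, norm_pow, Real.norm_eq_abs, Real.norm_eq_abs, Real.norm_eq_abs,
        Nat.abs_cast]
      gcongr)
    (Metric.mem_ball_self hR) (summable_besselCoeff_mul_pow hν 0)
    (by simp [R])
  refine key.congr_deriv ?_
  have hs : Summable fun k : ℕ => besselCoeff ν k * (k * z ^ (k - 1)) := by
    refine Summable.of_norm_bounded hsum fun k => ?_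
    rw [norm_mul, norm_mul, norm_pow, Real.norm_eq_abs, Real.norm_eq_abs, Real.norm_eq_abs,
      Nat.abs_cast]
    have hz : |z| ≤ R := by simp [R]
    gcongr
  rw [hs.tsum_eq_zero_add, besselEntire, ← tsum_neg]
  simp only [Nat.cast_zero, zero_mul, mul_zero, zero_add, Nat.add_sub_cancel]
  exact tsum_congr fun k => by rw [← hterm]; ring

lemma besselEntire_recurrence {ν : ℝ} (hν : 0 < ν) (z : ℝ) :
    z * besselEntire (ν + 2) z - (ν + 1) * besselEntire (ν + 1) z + besselEntire ν z = 0 := by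
  have hs := (summable_besselCoeff_mul_pow hν z).hasSum
  have hs1 := (summable_besselCoeff_mul_pow (ν := ν + 1) (by positivity) z).hasSum
  have hs2 := (summable_besselCoeff_mul_pow (ν := ν + 2) (by positivity) z).hasSum
  have hk : HasSum (fun k : ℕ => (k : ℝ) * besselCoeff (ν + 1) k * z ^ k)
      (-(z * besselEntire (ν + 2) z)) := by
    rw [← hasSum_nat_add_iff' 1]
    simp only [Finset.range_one, Finset.sum_singleton, Nat.cast_zero, zero_mul, sub_zero]
    refine (hs2.mul_left z).neg.congr_fun fun k => ?_
    have := succ_mul_besselCoeff_succ (ν + 1) k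
    rw [show ν + 1 + 1 = ν + 2 by ring] at this
    push_cast
    linear_combination z ^ (k + 1) * this
  have h := hk.add (hs1.mul_left (ν + 1))
  have h' := hs.unique (h.congr_fun fun k => by
    rw [besselCoeff_eq_mul_besselCoeff_add_one hν]; ring)
  change besselEntire ν z = -(z * besselEntire (ν + 2) z) + (ν + 1) * besselEntire (ν + 1) z at h'
  linarith

lemma besselJ_eq_rpow_mul_besselEntire (ν : ℝ) {x : ℝ} (hx : 0 < x) :
    besselJ ν x = (x / 2) ^ ν * besselEntire ν (x ^ 2 / 4) := by
  rw [besselJ, besselEntire, ← tsum_mul_left]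
  refine tsum_congr fun k => ?_
  have h : (x / 2) ^ (2 * (k : ℝ)) = (x ^ 2 / 4) ^ k := by
    rw [show 2 * (k : ℝ) = ((2 * k : ℕ) : ℝ) by push_cast; ring, Real.rpow_natCast, pow_mul]
    ring
  rw [Real.rpow_add (by positivity), h, besselCoeff]
  ring

lemma besselJ_add_two {ν : ℝ} (hν : 0 < ν) {x : ℝ} (hx : 0 < x) :
    besselJ (ν + 2) x = 2 * (ν + 1) / x * besselJ (ν + 1) x - besselJ ν x := by
  have h := besselEntire_recurrence hν (x ^ 2 / 4)
  have hx2 : 0 < x / 2 := by positivity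
  rw [besselJ_eq_rpow_mul_besselEntire _ hx, besselJ_eq_rpow_mul_besselEntire _ hx,
    besselJ_eq_rpow_mul_besselEntire _ hx, Real.rpow_add hx2, Real.rpow_add hx2, Real.rpow_one,
    Real.rpow_two]
  field_simp
  linear_combination h * 4

lemma hasDerivAt_besselJ {ν : ℝ} (hν : 0 < ν) {x : ℝ} (hx : 0 < x) :
    HasDerivAt (besselJ ν) (ν / x * besselJ ν x - besselJ (ν + 1) x) x := by
  have hx2 : 0 < x / 2 := by positivity
  have h1 : HasDerivAt (fun y : ℝ => (y / 2) ^ ν) (1 / 2 * ν * (x / 2) ^ (ν - 1)) x :=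
    ((hasDerivAt_id x).div_const 2).rpow_const (Or.inl hx2.ne')
  have h2 : HasDerivAt (fun y : ℝ => y ^ 2 / 4) (x / 2) x :=
    ((hasDerivAt_pow 2 x).div_const 4).congr_deriv (by push_cast; ring)
  have h3 : HasDerivAt (fun y : ℝ => besselEntire ν (y ^ 2 / 4))
      (-besselEntire (ν + 1) (x ^ 2 / 4) * (x / 2)) x :=
    HasDerivAt.comp (h₂ := besselEntire ν) x (hasDerivAt_besselEntire hν (x ^ 2 / 4)) h2
  have h4 := (h1.mul h3).congr_of_eventuallyEq
    (f₁ := besselJ ν) ((eventually_gt_nhds hx).mono fun y hy =>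
      besselJ_eq_rpow_mul_besselEntire ν hy)
  refine h4.congr_deriv ?_
  rw [besselJ_eq_rpow_mul_besselEntire _ hx, besselJ_eq_rpow_mul_besselEntire _ hx,
    Real.rpow_add hx2, Real.rpow_sub hx2, Real.rpow_one]
  field_simp
  ring

/-- `J_ν` is bounded on `[1, ∞)`: by Bessel's equation `(J_ν ^ 2 + J_ν' ^ 2) * exp (ν ^ 2 / x)` is
nonincreasing. -/
lemma exists_abs_besselJ_le_of_one_le {ν : ℝ} (hν : 0 < ν) :
    ∃ M : ℝ, 0 ≤ M ∧ ∀ x : ℝ, 1 ≤ x → |besselJ ν x| ≤ M := by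
  set p : ℝ → ℝ := fun x => ν * x⁻¹ * besselJ ν x - besselJ (ν + 1) x with hp
  set F : ℝ → ℝ := fun x => (besselJ ν x ^ 2 + p x ^ 2) * exp (ν ^ 2 * x⁻¹) with hF
  have hu (x : ℝ) (hx : 0 < x) : HasDerivAt (besselJ ν) (p x) x :=
    hasDerivAt_besselJ hν hx
  have hp' (x : ℝ) (hx : 0 < x) :
      HasDerivAt p (-(x⁻¹ * p x) + ν ^ 2 * x⁻¹ ^ 2 * besselJ ν x - besselJ ν x) x := by
    have hv := hasDerivAt_besselJ (ν := ν + 1) (by positivity) hx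
    have h := ((((hasDerivAt_inv hx.ne').const_mul ν).mul (hu x hx)).sub hv)
    refine h.congr_deriv ?_
    rw [show ν + 1 + 1 = ν + 2 by ring, besselJ_add_two hν hx]
    simp only [hp]
    field_simp
    ring
  have hF' (x : ℝ) (hx : 0 < x) : HasDerivAt F
      ((2 * besselJ ν x * p x + 2 * p x *
          (-(x⁻¹ * p x) + ν ^ 2 * x⁻¹ ^ 2 * besselJ ν x - besselJ ν x)
        - ν ^ 2 * x⁻¹ ^ 2 * (besselJ ν x ^ 2 + p x ^ 2)) * exp (ν ^ 2 * x⁻¹)) x := by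
    have h := (((hu x hx).pow 2).add ((hp' x hx).pow 2)).mul
      ((hasDerivAt_inv hx.ne').const_mul (ν ^ 2)).exp
    refine h.congr_deriv ?_
    simp only [Pi.add_apply, Pi.pow_apply]
    push_cast
    ring
  have hanti : AntitoneOn F (Ici 1) := by
    refine antitoneOn_of_deriv_nonpos (convex_Ici 1)
      (fun x hx => (hF' x (zero_lt_one.trans_le hx)).continuousAt.continuousWithinAt)
      (fun x hx => (hF' x ?_).differentiableAt.differentiableWithinAt) fun x hx => ?_
    · exact zero_lt_one.trans_le (interior_subset hx)
    · have hx0 : 0 < x := zero_lt_one.trans_le (interior_subset hx)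
      rw [(hF' x hx0).deriv]
      refine mul_nonpos_of_nonpos_of_nonneg ?_ (exp_pos _).le
      have h1 : 0 ≤ x⁻¹ * p x ^ 2 := by positivity
      have h2 : 0 ≤ (ν * x⁻¹) ^ 2 * (besselJ ν x - p x) ^ 2 := by positivity
      nlinarith
  refine ⟨√(F 1), Real.sqrt_nonneg _, fun x hx => Real.abs_le_sqrt ?_⟩
  have hx0 : 0 < x := zero_lt_one.trans_le hx
  refine le_trans ?_ (hanti (mem_Ici.2 le_rfl) (mem_Ici.2 hx) hx)
  have hexp : 1 ≤ exp (ν ^ 2 * x⁻¹) := Real.one_le_exp (by positivity)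
  simp only [hF]
  nlinarith [sq_nonneg (besselJ ν x), sq_nonneg (p x)]

lemma exists_abs_besselJ_le_rpow {μ ν : ℝ} (hμ : 0 < μ) (hν : μ ≤ ν) :
    ∃ M : ℝ, 0 < M ∧ ∀ x : ℝ, 0 < x → |besselJ ν x| ≤ M * x ^ μ := by
  have hν0 : 0 < ν := hμ.trans_le hν
  obtain ⟨M, hM0, hM⟩ := exists_abs_besselJ_le_of_one_le hν0
  have hcont : Continuous (besselEntire ν) :=
    continuous_iff_continuousAt.2 fun z => (hasDerivAt_besselEntire hν0 z).continuousAt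
  obtain ⟨B, hB⟩ := (isCompact_Icc (a := (0 : ℝ)) (b := 1)).exists_bound_of_continuousOn
    hcont.continuousOn
  have hB0 : 0 ≤ B := (norm_nonneg _).trans (hB 0 (by simp))
  refine ⟨M + B + 1, by positivity, fun x hx => ?_⟩
  have hxμ : 0 < x ^ μ := Real.rpow_pos_of_pos hx _
  rcases le_total 1 x with h1 | h1
  · have h2 : 1 ≤ x ^ μ := Real.one_le_rpow h1 hμ.le
    have h3 := hM x h1
    nlinarith
  · have h2 : (x / 2) ^ ν ≤ x ^ μ :=
      (Real.rpow_le_rpow (by positivity) (by linarith) hν0.le).trans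
        (Real.rpow_le_rpow_of_exponent_ge hx h1 hν)
    have h3 : |besselEntire ν (x ^ 2 / 4)| ≤ B := hB _ ⟨by positivity, by nlinarith⟩
    rw [besselJ_eq_rpow_mul_besselEntire ν hx, abs_mul, abs_of_nonneg (by positivity)]
    calc _ ≤ x ^ μ * B := by gcongr
      _ ≤ _ := by nlinarith

lemma integrableOn_one_add_rpow_mul_rpow {a b : ℝ} (hb : 0 ≤ b) (hab : b + 1 < a) :
    IntegrableOn (fun s : ℝ => (1 + s) ^ (-a) * s ^ b) (Ioi 0) := by
  have h : IntegrableOn (fun s : ℝ => (s + 1) ^ (b - a)) (Ioi 0) :=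
    integrableOn_add_rpow_Ioi_of_lt (by linarith) (by norm_num)
  refine h.mono' (Measurable.aestronglyMeasurable (by fun_prop)) ?_
  filter_upwards [ae_restrict_mem measurableSet_Ioi] with s hs
  have hs0 : 0 < s := hs
  rw [Real.norm_of_nonneg (by positivity)]
  calc _ ≤ (1 + s) ^ (-a) * (1 + s) ^ b := by
        gcongr
        linarith
    _ = _ := by
        rw [← Real.rpow_add (by positivity)]
        ring_nf

/-- The weighted Cauchy–Schwarz inequality embedding `L^{2,σ}` into `L^1`. -/
lemma weighted_integral_norm_le {σ b : ℝ} (hb : 0 ≤ b) (hσ : b + 1 < 2 * σ) {f : ℝ → ℂ}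
    (hf : Measurable f)
    (hfin : ∫⁻ s in Ioi (0 : ℝ),
      ENNReal.ofReal (‖f s‖ ^ (2 : ℕ) * (1 + s) ^ (2 * σ) * s ^ b) < ⊤) :
    IntegrableOn (fun s => ‖f s‖ * s ^ b) (Ioi 0) ∧
      ∫ s in Ioi (0 : ℝ), ‖f s‖ * s ^ b ≤
        √(∫ s in Ioi (0 : ℝ), ‖f s‖ ^ (2 : ℕ) * (1 + s) ^ (2 * σ) * s ^ b) *
          √(∫ s in Ioi (0 : ℝ), (1 + s) ^ (-(2 * σ)) * s ^ b) := by
  have hA := integrableOn_one_add_rpow_mul_rpow hb hσ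
  have hN : IntegrableOn (fun s => ‖f s‖ ^ (2 : ℕ) * (1 + s) ^ (2 * σ) * s ^ b) (Ioi 0) := by
    refine ⟨Measurable.aestronglyMeasurable (by fun_prop), ?_⟩
    rw [hasFiniteIntegral_iff_ofReal]
    · exact hfin
    · filter_upwards [ae_restrict_mem measurableSet_Ioi] with s hs
      have hs0 : 0 < s := hs
      exact (by positivity : (0 : ℝ) ≤ ‖f s‖ ^ (2 : ℕ) * (1 + s) ^ (2 * σ) * s ^ b)
  set F : ℝ → ℝ := fun s => √(‖f s‖ ^ (2 : ℕ) * (1 + s) ^ (2 * σ) * s ^ b) with hF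
  set G : ℝ → ℝ := fun s => √((1 + s) ^ (-(2 * σ)) * s ^ b) with hG
  have hFsq : ∀ᵐ s ∂volume.restrict (Ioi (0 : ℝ)),
      F s ^ 2 = ‖f s‖ ^ (2 : ℕ) * (1 + s) ^ (2 * σ) * s ^ b := by
    filter_upwards [ae_restrict_mem measurableSet_Ioi] with s hs
    have hs0 : 0 < s := hs
    exact Real.sq_sqrt (by positivity)
  have hGsq : ∀ᵐ s ∂volume.restrict (Ioi (0 : ℝ)),
      G s ^ 2 = (1 + s) ^ (-(2 * σ)) * s ^ b := by
    filter_upwards [ae_restrict_mem measurableSet_Ioi] with s hs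
    have hs0 : 0 < s := hs
    exact Real.sq_sqrt (by positivity)
  have hFG : ∀ᵐ s ∂volume.restrict (Ioi (0 : ℝ)), F s * G s = ‖f s‖ * s ^ b := by
    filter_upwards [ae_restrict_mem measurableSet_Ioi] with s hs
    have hs0 : 0 < s := hs
    have hw : (1 + s) ^ (2 * σ) * (1 + s) ^ (-(2 * σ)) = 1 := by
      rw [← Real.rpow_add (by positivity), add_neg_cancel, Real.rpow_zero]
    simp only [hF, hG]
    rw [← Real.sqrt_mul (by positivity), Real.sqrt_eq_iff_mul_self_eq (by positivity)
      (by positivity)]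
    linear_combination (‖f s‖ ^ 2 * (s ^ b) ^ 2) * hw
  have hFL : MemLp F 2 (volume.restrict (Ioi 0)) := by
    rw [memLp_two_iff_integrable_sq (Measurable.aestronglyMeasurable (by fun_prop))]
    exact hN.congr (hFsq.mono fun s hs => hs.symm)
  have hGL : MemLp G 2 (volume.restrict (Ioi 0)) := by
    rw [memLp_two_iff_integrable_sq (Measurable.aestronglyMeasurable (by fun_prop))]
    exact hA.congr (hGsq.mono fun s hs => hs.symm)
  refine ⟨(hFL.integrable_mul hGL).congr hFG, ?_⟩
  have hCS := integral_mul_le_Lp_mul_Lq_of_nonneg (μ := volume.restrict (Ioi (0 : ℝ)))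
    Real.HolderConjugate.two_two (Filter.Eventually.of_forall fun s => Real.sqrt_nonneg _)
    (Filter.Eventually.of_forall fun s => Real.sqrt_nonneg _)
    (f := F) (g := G) (by simpa using hFL) (by simpa using hGL)
  simp only [Real.rpow_two] at hCS
  rwa [integral_congr_ae hFG, integral_congr_ae hFsq, integral_congr_ae hGsq,
    ← Real.sqrt_eq_rpow, ← Real.sqrt_eq_rpow] at hCS

lemma abs_bessel_kernel_le {μ ν M : ℝ} (hM : 0 ≤ M)
    (hJ : ∀ x : ℝ, 0 < x → |besselJ ν x| ≤ M * x ^ μ) {lam r s : ℝ} (hlam : 0 < lam)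
    (hr : 0 < r) (hs : 0 < s) :
    |π / 2 * (r * s) ^ (-μ) * besselJ ν (lam * r) * besselJ ν (lam * s)| ≤
      π / 2 * M ^ 2 * lam ^ (2 * μ) := by
  have h1 := hJ _ (mul_pos hlam hr)
  have h2 := hJ _ (mul_pos hlam hs)
  rw [abs_mul, abs_mul, abs_of_nonneg (by positivity)]
  calc _ ≤ π / 2 * (r * s) ^ (-μ) * (M * (lam * r) ^ μ) * (M * (lam * s) ^ μ) := by gcongr
    _ = _ := by
      have hr' := (Real.rpow_pos_of_pos hr μ).ne'
      have hs' := (Real.rpow_pos_of_pos hs μ).ne'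
      rw [Real.rpow_neg (by positivity), Real.mul_rpow hr.le hs.le, Real.mul_rpow hlam.le hr.le,
        Real.mul_rpow hlam.le hs.le, two_mul, Real.rpow_add hlam]
      field_simp

theorem imag_resolvent_L2_weighted_bound_lowfreq
    (n : ℕ) (hn : 3 ≤ n) (ν : ℝ) (hν : ((n : ℝ) - 2) / 2 ≤ ν)
    (σ : ℝ) (hσ : (n : ℝ) / 2 < σ) :
    ∃ C > (0 : ℝ), ∀ lam : ℝ, 0 < lam → lam ≤ 1 →
      ∀ f : ℝ → ℂ, Measurable f →
        (∫⁻ s in Ioi (0 : ℝ),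
            ENNReal.ofReal (‖f s‖ ^ (2 : ℕ) * (1 + s) ^ (2 * σ) * s ^ ((n : ℝ) - 1)) < ⊤) →
        Real.sqrt (∫ r in Ioi (0 : ℝ),
            ‖∫ s in Ioi (0 : ℝ),
                ((π / 2 * (r * s) ^ (-(((n : ℝ) - 2) / 2)) *
                  besselJ ν (lam * r) * besselJ ν (lam * s) : ℝ) : ℂ) *
                  f s * ((s ^ ((n : ℝ) - 1) : ℝ) : ℂ)‖ ^ (2 : ℕ) *
              (1 + r) ^ (-(2 * σ)) * r ^ ((n : ℝ) - 1))
          ≤ C * lam ^ ((n : ℝ) - 2) *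
              Real.sqrt (∫ s in Ioi (0 : ℝ),
                ‖f s‖ ^ (2 : ℕ) * (1 + s) ^ (2 * σ) * s ^ ((n : ℝ) - 1)) := by
  have hn' : (3 : ℝ) ≤ n := by exact_mod_cast hn
  obtain ⟨M, hM0, hM⟩ := exists_abs_besselJ_le_rpow (by linarith) hν
  have hb : (0 : ℝ) ≤ n - 1 := by linarith
  have hbσ : (n : ℝ) - 1 + 1 < 2 * σ := by linarith
  have hAint := integrableOn_one_add_rpow_mul_rpow hb hbσ
  set A : ℝ := ∫ s in Ioi (0 : ℝ), (1 + s) ^ (-(2 * σ)) * s ^ ((n : ℝ) - 1) with hA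
  have hA0 : 0 ≤ A := setIntegral_nonneg measurableSet_Ioi fun s hs => by
    have hs0 : 0 < s := hs
    positivity
  refine ⟨π / 2 * M ^ 2 * A + 1, by positivity, fun lam hlam _ f hf hfin => ?_⟩
  obtain ⟨hint, hCS⟩ := weighted_integral_norm_le hb hbσ hf hfin
  set N : ℝ := √(∫ s in Ioi (0 : ℝ), ‖f s‖ ^ (2 : ℕ) * (1 + s) ^ (2 * σ) * s ^ ((n : ℝ) - 1))
  have hN0 : 0 ≤ N := Real.sqrt_nonneg _
  set L : ℝ := π / 2 * M ^ 2 * lam ^ ((n : ℝ) - 2) with hL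
  have hL0 : 0 ≤ L := by positivity
  have hinner (r : ℝ) (hr : 0 < r) : ‖∫ s in Ioi (0 : ℝ),
      ((π / 2 * (r * s) ^ (-(((n : ℝ) - 2) / 2)) *
        besselJ ν (lam * r) * besselJ ν (lam * s) : ℝ) : ℂ) *
        f s * ((s ^ ((n : ℝ) - 1) : ℝ) : ℂ)‖ ≤ L * (N * √A) := by
    calc _ ≤ ∫ s in Ioi (0 : ℝ), L * (‖f s‖ * s ^ ((n : ℝ) - 1)) := by
          refine norm_integral_le_of_norm_le (hint.const_mul L) ?_
          filter_upwards [ae_restrict_mem measurableSet_Ioi] with s hs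
          have hs0 : 0 < s := hs
          have hK := abs_bessel_kernel_le hM0.le hM hlam hr hs0
          rw [mul_div_cancel₀ _ (two_ne_zero' ℝ)] at hK
          rw [norm_mul, norm_mul, Complex.norm_real, Complex.norm_real, mul_assoc,
            Real.norm_of_nonneg (r := s ^ ((n : ℝ) - 1)) (by positivity)]
          gcongr
          exact hK
      _ = L * ∫ s in Ioi (0 : ℝ), ‖f s‖ * s ^ ((n : ℝ) - 1) := integral_const_mul _ _
      _ ≤ _ := by gcongr
  have houter : (∫ r in Ioi (0 : ℝ),
      ‖∫ s in Ioi (0 : ℝ),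
        ((π / 2 * (r * s) ^ (-(((n : ℝ) - 2) / 2)) *
          besselJ ν (lam * r) * besselJ ν (lam * s) : ℝ) : ℂ) *
          f s * ((s ^ ((n : ℝ) - 1) : ℝ) : ℂ)‖ ^ (2 : ℕ) *
        (1 + r) ^ (-(2 * σ)) * r ^ ((n : ℝ) - 1)) ≤ (L * N * A) ^ 2 := by
    calc _ ≤ ∫ r in Ioi (0 : ℝ), (L * (N * √A)) ^ 2 *
            ((1 + r) ^ (-(2 * σ)) * r ^ ((n : ℝ) - 1)) := by
          refine integral_mono_of_nonneg ?_ (hAint.const_mul _) ?_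
          · filter_upwards [ae_restrict_mem measurableSet_Ioi] with r hr
            have hr0 : 0 < r := hr
            simp only [Pi.zero_apply]
            positivity
          · filter_upwards [ae_restrict_mem measurableSet_Ioi] with r hr
            have hr0 : 0 < r := hr
            have h := hinner r hr0
            simp only [mul_assoc _ ((1 + r) ^ (-(2 * σ))) (r ^ ((n : ℝ) - 1))]
            gcongr
      _ = (L * (N * √A)) ^ 2 * A := integral_const_mul _ _
      _ = _ := by
          linear_combination (L * N) ^ 2 * A * Real.sq_sqrt hA0
  refine (Real.sqrt_le_sqrt houter).trans ?_
  rw [Real.sqrt_sq (by positivity)]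
  have hlp : 0 ≤ lam ^ ((n : ℝ) - 2) * N := by positivity
  rw [hL]
  nlinarith
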